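/- arXiv:0810.1773 — 4 statements merged into one kernel-verified Lean document; each statement's English description precedes it below -/
import Mathlib

section
/- Let B > 0, α > 0 and S > 0 be real numbers. Then (1/B)·∫₀^B log₂(1 + S·e^{−α√f}) df ≥ (1/3)·log₂(S) + (2/3)·log₂(S·e^{−α√B}). -/
/-- lower bound on spectral efficiency under the Werner model:
`(1/B)·∫₀^B log₂(1 + S·e^{−α√f}) df ≥ (1/3)·log₂ S + (2/3)·log₂(S·e^{−α√B})`. -/
theorem stmt_10 (B α S : ℝ) (hB : 0 < B) (hα : 0 < α) (hS : 0 < S) :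
    (1 / 3) * Real.logb 2 S
      + (2 / 3) * Real.logb 2 (S * Real.exp (-α * Real.sqrt B))
      ≤ (1 / B) * ∫ f in (0 : ℝ)..B,
          Real.logb 2 (1 + S * Real.exp (-α * Real.sqrt f)) := by
  have hl : 0 < Real.log 2 := Real.log_pos (by norm_num)
  have key : ∀ f : ℝ, Real.logb 2 (S * Real.exp (-α * Real.sqrt f))
      = Real.log S / Real.log 2 - α / Real.log 2 * Real.sqrt f := by
    intro f
    rw [Real.logb, Real.log_mul hS.ne' (Real.exp_pos _).ne', Real.log_exp]
    ring
  have hsq : ∫ f in (0 : ℝ)..B, Real.sqrt f = 2 / 3 * (B * Real.sqrt B) := by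
    simp only [Real.sqrt_eq_rpow]
    rw [integral_rpow (Or.inl (by norm_num)), Real.zero_rpow (by norm_num),
      Real.rpow_add hB, Real.rpow_one]
    ring
  have hint : ∫ f in (0 : ℝ)..B, (Real.log S / Real.log 2 - α / Real.log 2 * Real.sqrt f)
      = B * (Real.log S / Real.log 2) - α / Real.log 2 * (2 / 3 * (B * Real.sqrt B)) := by
    rw [intervalIntegral.integral_sub (by simp)
      (Continuous.intervalIntegrable (by fun_prop) _ _),
      intervalIntegral.integral_const_mul, hsq]
    simp
    ring
  have hmono : ∫ f in (0 : ℝ)..B, (Real.log S / Real.log 2 - α / Real.log 2 * Real.sqrt f)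
      ≤ ∫ f in (0 : ℝ)..B, Real.logb 2 (1 + S * Real.exp (-α * Real.sqrt f)) := by
    apply intervalIntegral.integral_mono_on hB.le
    · exact Continuous.intervalIntegrable (by fun_prop) _ _
    · apply Continuous.intervalIntegrable
      unfold Real.logb
      refine Continuous.div_const (Continuous.log (by fun_prop) ?_) _
      intro x
      positivity
    · intro f _
      rw [← key]
      exact Real.logb_le_logb_of_le (by norm_num) (by positivity) (by linarith)
  rw [hint] at hmono
  refine le_trans (le_of_eq ?_) (mul_le_mul_of_nonneg_left hmono (by positivity))
  rw [key, Real.logb]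
  field_simp
  ring
end

section
/- Let P > 0, σ² > 0, α > 0, B > 0, a ≥ 1, b ≥ 0 and μ ≥ 0 be real, and set f(x) = (P/σ²)·e^{−α√x}. Then (1/B)·∫₀^B log₂(1 + μ·(a+bx)²·f(x)) dx ≤ (e^{α√B}/(α²·B))·(2a² + 24·a·b/α² + 240·(b/α²)²)·log₂(1 + μ·f(B)). -/
theorem aux_log (c y : ℝ) (hc : 1 ≤ c) (hy : 0 ≤ y) :
    Real.logb 2 (1 + c * y) ≤ c * Real.logb 2 (1 + y) := by
  rw [← Real.logb_rpow_eq_mul_logb_of_pos (by linarith)]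
  apply Real.logb_le_logb_of_le (by norm_num) (by positivity)
  exact one_add_mul_self_le_rpow_one_add (by linarith) hc

/-- Polynomial part of the antiderivative. -/
noncomputable def auxQ (α a b s : ℝ) : ℝ :=
  2 * a ^ 2 * (s / α + 1 / α ^ 2)
  + 4 * a * b * (s ^ 3 / α + 3 * s ^ 2 / α ^ 2 + 6 * s / α ^ 3 + 6 / α ^ 4)
  + 2 * b ^ 2 * (s ^ 5 / α + 5 * s ^ 4 / α ^ 2 + 20 * s ^ 3 / α ^ 3 + 60 * s ^ 2 / α ^ 4
      + 120 * s / α ^ 5 + 120 / α ^ 6)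

theorem auxQ_deriv (α a b s : ℝ) (hα : 0 < α) :
    HasDerivAt (fun s => -(Real.exp (-α * s) * auxQ α a b s))
      (Real.exp (-α * s) * (2 * s * (a + b * s ^ 2) ^ 2)) s := by
  have hid := hasDerivAt_id' s
  have h1 := ((hid.div_const α).add_const (1 / α ^ 2)).const_mul (2 * a ^ 2)
  have h2 := (((((hid.pow 3).div_const α).add (((hid.pow 2).const_mul 3).div_const (α ^ 2))).add
    ((hid.const_mul 6).div_const (α ^ 3))).add_const (6 / α ^ 4)).const_mul (4 * a * b)
  have h3 := (((((((hid.pow 5).div_const α).add (((hid.pow 4).const_mul 5).div_const (α ^ 2))).add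
    (((hid.pow 3).const_mul 20).div_const (α ^ 3))).add
    (((hid.pow 2).const_mul 60).div_const (α ^ 4))).add
    ((hid.const_mul 120).div_const (α ^ 5))).add_const (120 / α ^ 6)).const_mul (2 * b ^ 2)
  have h := (((hid.const_mul (-α)).exp).mul ((h1.add h2).add h3)).neg
  refine HasDerivAt.congr_deriv (f := fun s => -(Real.exp (-α * s) * auxQ α a b s)) h ?_
  simp only [Pi.add_apply, Pi.pow_apply]
  push_cast
  field_simp
  ring

theorem aux_int (α a b B : ℝ) (hα : 0 < α) (hB : 0 < B) (ha : 0 ≤ a) (hb : 0 ≤ b) :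
    ∫ x in (0 : ℝ)..B, (a + b * x) ^ 2 * Real.exp (-α * Real.sqrt x)
      ≤ (1 / α ^ 2) * (2 * a ^ 2 + 24 * a * b / α ^ 2 + 240 * (b / α ^ 2) ^ 2) := by
  have hc : Continuous (fun s => -(Real.exp (-α * s) * auxQ α a b s)) :=
    continuous_iff_continuousAt.2 fun s => (auxQ_deriv α a b s hα).continuousAt
  have key := intervalIntegral.integral_eq_sub_of_hasDerivAt_of_le
    (f := fun x => -(Real.exp (-α * Real.sqrt x) * auxQ α a b (Real.sqrt x)))
    (f' := fun x => (a + b * x) ^ 2 * Real.exp (-α * Real.sqrt x)) hB.le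
    (hc.comp Real.continuous_sqrt).continuousOn
    (fun x hx => by
      have hx0 : 0 < x := hx.1
      have hs : 0 < Real.sqrt x := Real.sqrt_pos.2 hx0
      have h := (auxQ_deriv α a b (Real.sqrt x) hα).comp x (Real.hasDerivAt_sqrt hx0.ne')
      refine HasDerivAt.congr_deriv h ?_
      rw [Real.sq_sqrt hx0.le]
      field_simp)
    (Continuous.intervalIntegrable (by fun_prop) _ _)
  rw [key]
  have h0 : 0 ≤ Real.exp (-α * Real.sqrt B) * auxQ α a b (Real.sqrt B) := by
    unfold auxQ
    have := Real.sqrt_nonneg B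
    positivity
  have h1 : auxQ α a b 0 =
      (1 / α ^ 2) * (2 * a ^ 2 + 24 * a * b / α ^ 2 + 240 * (b / α ^ 2) ^ 2) := by
    unfold auxQ
    field_simp
    ring
  simp only [Real.sqrt_zero, mul_zero, Real.exp_zero, one_mul]
  linarith


/-- with `f(x) = (P/σ²)e^{−α√x}`,
`(1/B)∫₀^B log₂(1 + μ(a+bx)²f(x)) dx ≤
(e^{α√B}/(α²B))·(2a² + 24ab/α² + 240(b/α²)²)·log₂(1 + μ·f(B))`. -/
theorem stmt_13 (P σ2 α B a b μ : ℝ)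
    (hP : 0 < P) (hσ : 0 < σ2) (hα : 0 < α) (hB : 0 < B)
    (ha : 1 ≤ a) (hb : 0 ≤ b) (hμ : 0 ≤ μ)
    (f : ℝ → ℝ) (hf : ∀ x, f x = (P / σ2) * Real.exp (-α * Real.sqrt x)) :
    (1 / B) * ∫ x in (0 : ℝ)..B, Real.logb 2 (1 + μ * (a + b * x) ^ 2 * f x)
      ≤ (Real.exp (α * Real.sqrt B) / (α ^ 2 * B))
          * (2 * a ^ 2 + 24 * a * b / α ^ 2 + 240 * (b / α ^ 2) ^ 2)
          * Real.logb 2 (1 + μ * f B) := by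
  have hfB : 0 ≤ μ * f B := by rw [hf]; positivity
  set L := Real.logb 2 (1 + μ * f B) with hL
  have hL0 : 0 ≤ L := Real.logb_nonneg (by norm_num) (by linarith)
  have hfc : Continuous f := by
    rw [show f = fun x => (P / σ2) * Real.exp (-α * Real.sqrt x) from funext hf]
    fun_prop
  have hmono : ∫ x in (0 : ℝ)..B, Real.logb 2 (1 + μ * (a + b * x) ^ 2 * f x)
      ≤ ∫ x in (0 : ℝ)..B, (Real.exp (α * Real.sqrt B) * L) *
          ((a + b * x) ^ 2 * Real.exp (-α * Real.sqrt x)) := by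
    apply intervalIntegral.integral_mono_on hB.le
    · apply Continuous.intervalIntegrable
      unfold Real.logb
      refine Continuous.div_const (Continuous.log (by fun_prop) fun x => ?_) _
      have : 0 ≤ μ * (a + b * x) ^ 2 * f x := by rw [hf]; positivity
      positivity
    · exact Continuous.intervalIntegrable (by fun_prop) _ _
    · intro x hx
      have hs : Real.sqrt x ≤ Real.sqrt B := Real.sqrt_le_sqrt hx.2
      have h1 : 1 ≤ Real.exp (α * Real.sqrt B) * Real.exp (-α * Real.sqrt x) := by
        rw [← Real.exp_add]
        apply Real.one_le_exp
        nlinarith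
      have h2 : 1 ≤ (a + b * x) ^ 2 := by
        have := mul_nonneg hb hx.1
        nlinarith
      have h3 := aux_log ((a + b * x) ^ 2 *
        (Real.exp (α * Real.sqrt B) * Real.exp (-α * Real.sqrt x))) (μ * f B)
        (one_le_mul_of_one_le_of_one_le h2 h1) hfB
      have h4 : μ * (a + b * x) ^ 2 * f x = (a + b * x) ^ 2 *
          (Real.exp (α * Real.sqrt B) * Real.exp (-α * Real.sqrt x)) * (μ * f B) := by
        have h5 : Real.exp (α * Real.sqrt B) * Real.exp (-α * Real.sqrt B) = 1 := by
          rw [← Real.exp_add]; simp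
        rw [hf, hf]
        linear_combination (-(μ * (a + b * x) ^ 2 * (P / σ2) * Real.exp (-α * Real.sqrt x))) * h5
      rw [h4]
      refine h3.trans (le_of_eq ?_)
      rw [← hL]
      ring
  rw [intervalIntegral.integral_const_mul] at hmono
  have hI := aux_int α a b B hα hB (by linarith) hb
  have hK : 0 ≤ Real.exp (α * Real.sqrt B) * L := by positivity
  calc _ ≤ (1 / B) * ((Real.exp (α * Real.sqrt B) * L) *
        ((1 / α ^ 2) * (2 * a ^ 2 + 24 * a * b / α ^ 2 + 240 * (b / α ^ 2) ^ 2))) := by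
        apply mul_le_mul_of_nonneg_left _ (by positivity)
        exact hmono.trans (mul_le_mul_of_nonneg_left hI hK)
    _ = _ := by field_simp
end

section
/- Let P > 0, σ² > 0, α > 0, B > 0, a ≥ 1, b ≥ 0 and μ ≥ 0 be real, and set f(x) = (P/σ²)·e^{−α√x}. Then (1/B)·∫₀^B log₂(1 + μ·(a+bx)²·f(x)) dx ≤ (2P/(ln(2)·α²·B·σ²))·(a² + 12·a·b/α² + 120·(b/α²)²)·μ. -/
open MeasureTheory Set in
lemma moment_bound (α B : ℝ) (hα : 0 < α) (hB : 0 < B) (n : ℕ) :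
    ∫ x in (0 : ℝ)..B, x ^ n * Real.exp (-α * Real.sqrt x)
      ≤ 2 * ((2 * n + 1).factorial : ℝ) / α ^ (2 * n + 2) := by
  have hn : (-1 : ℝ) < n := by have : (0 : ℝ) ≤ n := n.cast_nonneg
                               linarith
  have hI := integrableOn_rpow_mul_exp_neg_mul_rpow hn (one_half_pos (α := ℝ)) hα
  have hE := integral_rpow_mul_exp_neg_mul_rpow (one_half_pos (α := ℝ)) hn hα
  simp only [← Real.sqrt_eq_rpow, Real.rpow_natCast] at hI hE
  have e1 : ((n : ℝ) + 1) / (1 / 2) = ((2 * n + 1 : ℕ) : ℝ) + 1 := by push_cast; ring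
  have e2 : -((n : ℝ) + 1) / (1 / 2) = -((2 * n + 2 : ℕ) : ℝ) := by push_cast; ring
  rw [e1, e2, Real.Gamma_nat_eq_factorial, Real.rpow_neg hα.le, Real.rpow_natCast] at hE
  rw [intervalIntegral.integral_of_le hB.le]
  calc _ ≤ ∫ x in Ioi (0 : ℝ), x ^ n * Real.exp (-α * Real.sqrt x) := by
        apply setIntegral_mono_set hI
        · filter_upwards [ae_restrict_mem measurableSet_Ioi] with x hx
          have : (0 : ℝ) < x := hx
          simp only [Pi.zero_apply]
          positivity
        · exact Ioc_subset_Ioi_self.eventuallyLE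
    _ = _ := by rw [hE]; field_simp


/-- with `f(x) = (P/σ²)e^{−α√x}`,
`(1/B)∫₀^B log₂(1 + μ(a+bx)²f(x)) dx ≤
(2P/(ln 2·α²·B·σ²))·(a² + 12ab/α² + 120(b/α²)²)·μ`. -/
theorem stmt_14 (P σ2 α B a b μ : ℝ)
    (hP : 0 < P) (hσ : 0 < σ2) (hα : 0 < α) (hB : 0 < B)
    (ha : 1 ≤ a) (hb : 0 ≤ b) (hμ : 0 ≤ μ)
    (f : ℝ → ℝ) (hf : ∀ x, f x = (P / σ2) * Real.exp (-α * Real.sqrt x)) :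
    (1 / B) * ∫ x in (0 : ℝ)..B, Real.logb 2 (1 + μ * (a + b * x) ^ 2 * f x)
      ≤ (2 * P / (Real.log 2 * α ^ 2 * B * σ2))
          * (a ^ 2 + 12 * a * b / α ^ 2 + 120 * (b / α ^ 2) ^ 2) * μ := by

  have hl2 : 0 < Real.log 2 := Real.log_pos one_lt_two
  have hnn : ∀ x, 0 ≤ μ * (a + b * x) ^ 2 * f x := fun x => by rw [hf]; positivity
  have hfc : Continuous f := by
    rw [show f = _ from funext hf]; fun_prop
  have hmono : ∫ x in (0 : ℝ)..B, Real.logb 2 (1 + μ * (a + b * x) ^ 2 * f x)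
      ≤ ∫ x in (0 : ℝ)..B, (μ * (a + b * x) ^ 2 * f x) / Real.log 2 := by
    apply intervalIntegral.integral_mono_on hB.le
    · apply Continuous.intervalIntegrable
      unfold Real.logb
      apply Continuous.div_const
      apply Continuous.log (by fun_prop)
      intro x
      have := hnn x
      positivity
    · apply Continuous.intervalIntegrable
      fun_prop
    · intro x _
      unfold Real.logb
      gcongr
      have := Real.log_le_sub_one_of_pos (show 0 < 1 + μ * (a + b * x) ^ 2 * f x by
        linarith [hnn x])
      linarith
  have hci : ∀ n : ℕ, ∀ c : ℝ, IntervalIntegrable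
      (fun x => c * (x ^ n * Real.exp (-α * Real.sqrt x))) MeasureTheory.volume 0 B := fun n c =>
    Continuous.intervalIntegrable (by fun_prop) _ _
  have hsplit : ∫ x in (0 : ℝ)..B, (μ * (a + b * x) ^ 2 * f x) / Real.log 2
      = (μ * P / (σ2 * Real.log 2)) *
        (a ^ 2 * (∫ x in (0 : ℝ)..B, x ^ 0 * Real.exp (-α * Real.sqrt x))
        + 2 * a * b * (∫ x in (0 : ℝ)..B, x ^ 1 * Real.exp (-α * Real.sqrt x))
        + b ^ 2 * (∫ x in (0 : ℝ)..B, x ^ 2 * Real.exp (-α * Real.sqrt x))) := by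
    simp only [← intervalIntegral.integral_const_mul]
    rw [← intervalIntegral.integral_add (hci 0 _) (hci 1 _),
      ← intervalIntegral.integral_add ((hci 0 _).add (hci 1 _)) (hci 2 _),
      ← intervalIntegral.integral_const_mul]
    congr 1
    ext x
    rw [hf]
    field_simp
    ring
  have h0 := moment_bound α B hα hB 0
  have h1 := moment_bound α B hα hB 1
  have h2 := moment_bound α B hα hB 2
  rw [hsplit] at hmono
  have ha0 : 0 ≤ a := by linarith
  calc _ ≤ (1 / B) * ((μ * P / (σ2 * Real.log 2)) *
        (a ^ 2 * (2 * ((2 * 0 + 1).factorial : ℝ) / α ^ (2 * 0 + 2))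
        + 2 * a * b * (2 * ((2 * 1 + 1).factorial : ℝ) / α ^ (2 * 1 + 2))
        + b ^ 2 * (2 * ((2 * 2 + 1).factorial : ℝ) / α ^ (2 * 2 + 2)))) := by
        gcongr
        refine hmono.trans ?_
        gcongr
    _ = _ := by
        norm_num [Nat.factorial]
        field_simp
        ring
end

section
/- Let p ≥ 2 be an integer, let β > 0, B > 0, P > 0, σ² > 0, γ₁ ≥ 0, γ₂ ≥ 0, Γ ≥ 1 be real, and let d ≥ 3 be real. Define ρ = (1+γ₁)² + 12(1+γ₁)·γ₂/β² + 240·(γ₂/β²)², ξ = (4/ln 2)·(p−1)·(P/σ²)·(1/(β²·B))·ρ, and c = (1/3)·log₂(P/(σ²·Γ)) + (2/3)·log₂((P/(σ²·Γ))·e^{−β√B}); assume c > 0. Let L̄ = (1/B)·∫₀^B log₂(1 + 2(p−1)·2^{−2d}·(1+γ₁+γ₂·f)²·(P/σ²)·e^{−β√f}) df − 2·log₂(1 − 2^{−d+1.5}) and R = ∫₀^B log₂(1 + (P/(σ²·Γ))·e^{−β√f}) df. Then L̄·B / R ≤ (ξ/c)·2^{−2d} + (1/c)·2^{−d+3.5}.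 -/
lemma aux_int_loss (β B a γ : ℝ) (hβ : 0 < β) (hB : 0 < B) (ha : 0 ≤ a) (hγ : 0 ≤ γ) :
    ∫ f in (0 : ℝ)..B, (a + γ * f) ^ 2 * Real.exp (-β * Real.sqrt f)
      ≤ 2 / β ^ 2 * (a ^ 2 + 12 * a * γ / β ^ 2 + 240 * (γ / β ^ 2) ^ 2) := by
  obtain ⟨b, hb⟩ : ∃ b, b = 1 / β := ⟨_, rfl⟩
  have hb0 : 0 < b := by rw [hb]; positivity
  have hβb : β * b = 1 := by rw [hb]; field_simp
  set Q : ℝ → ℝ := fun s => 2 * a ^ 2 * (s * b + b ^ 2)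
    + 4 * a * γ * (s ^ 3 * b + 3 * s ^ 2 * b ^ 2 + 6 * s * b ^ 3 + 6 * b ^ 4)
    + 2 * γ ^ 2 * (s ^ 5 * b + 5 * s ^ 4 * b ^ 2 + 20 * s ^ 3 * b ^ 3 + 60 * s ^ 2 * b ^ 4
      + 120 * s * b ^ 5 + 120 * b ^ 6) with hQ
  have hQd : ∀ s, HasDerivAt Q (2 * a ^ 2 * b
      + 4 * a * γ * (3 * s ^ 2 * b + 6 * s * b ^ 2 + 6 * b ^ 3)
      + 2 * γ ^ 2 * (5 * s ^ 4 * b + 20 * s ^ 3 * b ^ 2 + 60 * s ^ 2 * b ^ 3 + 120 * s * b ^ 4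
      + 120 * b ^ 5)) s := by
    intro s
    have h1 := hasDerivAt_id' s
    have h2 := hasDerivAt_pow 2 s
    have h3 := hasDerivAt_pow 3 s
    have h4 := hasDerivAt_pow 4 s
    have h5 := hasDerivAt_pow 5 s
    have := ((((h1.mul_const b).add_const (b ^ 2)).const_mul (2 * a ^ 2)).add
      ((((h3.mul_const b).add ((h2.const_mul 3).mul_const (b ^ 2))).add
        ((h1.const_mul 6).mul_const (b ^ 3))).add_const (6 * b ^ 4) |>.const_mul (4 * a * γ))).add
      (((((((h5.mul_const b).add ((h4.const_mul 5).mul_const (b ^ 2))).add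
        ((h3.const_mul 20).mul_const (b ^ 3))).add ((h2.const_mul 60).mul_const (b ^ 4))).add
        ((h1.const_mul 120).mul_const (b ^ 5))).add_const (120 * b ^ 6)).const_mul (2 * γ ^ 2))
    refine this.congr_deriv ?_
    norm_num
    ring
  have hQc : Continuous Q := by rw [hQ]; fun_prop
  have key : ∫ f in (0 : ℝ)..B, (a + γ * f) ^ 2 * Real.exp (-β * Real.sqrt f)
      = -(Q (Real.sqrt B) * Real.exp (-β * Real.sqrt B))
        - -(Q (Real.sqrt 0) * Real.exp (-β * Real.sqrt 0)) := by
    refine intervalIntegral.integral_eq_sub_of_hasDerivAt_of_le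
      (f := fun f => -(Q (Real.sqrt f) * Real.exp (-β * Real.sqrt f))) hB.le ?_ ?_ ?_
    · have : Continuous fun f => Q (Real.sqrt f) := hQc.comp Real.continuous_sqrt
      exact (Continuous.neg (this.mul (by fun_prop))).continuousOn
    · intro x hx
      have hx0 : 0 < x := hx.1
      have hs0 : 0 < Real.sqrt x := Real.sqrt_pos.2 hx0
      have hs := Real.hasDerivAt_sqrt hx0.ne'
      have h := (((hQd (Real.sqrt x)).comp x hs).mul ((hs.const_mul (-β)).exp)).neg
      refine h.congr_deriv ?_
      have hxs : x = Real.sqrt x ^ 2 := (Real.sq_sqrt hx0.le).symm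
      simp only [Function.comp, hQ]
      set s := Real.sqrt x
      rw [hxs]
      have hβ' : β = b⁻¹ := by rw [hb]; simp
      generalize Real.exp (-β * s) = E
      rw [hβ']
      field_simp
      ring
    · exact Continuous.intervalIntegrable (by fun_prop) _ _
  have hQB : 0 ≤ Q (Real.sqrt B) * Real.exp (-β * Real.sqrt B) := by
    have := Real.sqrt_nonneg B
    simp only [hQ]; positivity
  have hQ0 : Q (Real.sqrt 0) * Real.exp (-β * Real.sqrt 0)
      = 2 * a ^ 2 * b ^ 2 + 24 * a * γ * b ^ 4 + 240 * γ ^ 2 * b ^ 6 := by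
    simp [hQ]; ring
  rw [key, hQ0]
  have : 2 / β ^ 2 * (a ^ 2 + 12 * a * γ / β ^ 2 + 240 * (γ / β ^ 2) ^ 2)
      = 2 * a ^ 2 * b ^ 2 + 24 * a * γ * b ^ 4 + 480 * γ ^ 2 * b ^ 6 := by
    rw [hb]; field_simp; ring
  rw [this]
  have : 0 ≤ γ ^ 2 * b ^ 6 := by positivity
  linarith

lemma aux_int_sqrt (B : ℝ) (hB : 0 < B) :
    ∫ f in (0 : ℝ)..B, Real.sqrt f = 2 / 3 * (B * Real.sqrt B) := by
  have := intervalIntegral.integral_eq_sub_of_hasDerivAt_of_le (a := 0) (b := B)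
      (f := fun f => 2 / 3 * (f * Real.sqrt f)) (f' := fun f => Real.sqrt f) hB.le
      (by fun_prop) ?_ (Real.continuous_sqrt.intervalIntegrable _ _)
  · rw [this]; simp
  · intro x hx
    have hx0 : 0 < x := hx.1
    have hs0 : 0 < Real.sqrt x := Real.sqrt_pos.2 hx0
    refine (((hasDerivAt_id' x).mul (Real.hasDerivAt_sqrt hx0.ne')).const_mul (2 / 3)).congr_deriv ?_
    have hxs : x = Real.sqrt x ^ 2 := (Real.sq_sqrt hx0.le).symm
    set s := Real.sqrt x
    rw [hxs]; field_simp; ring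

lemma aux_log_s16 (x : ℝ) (h0 : 0 ≤ x) (h1 : x ≤ 1 / 2) :
    -(2 * Real.logb 2 (1 - x)) ≤ 4 * x := by
  have hl : 0 < Real.log 2 := Real.log_pos (by norm_num)
  have h := strictConcaveOn_log_Ioi.concaveOn.2 (show (1 : ℝ) ∈ Set.Ioi 0 by norm_num)
    (show (1 / 2 : ℝ) ∈ Set.Ioi 0 by norm_num)
    (show 0 ≤ 1 - 2 * x by linarith) (show 0 ≤ 2 * x by linarith) (by ring)
  simp only [smul_eq_mul, Real.log_one] at h
  rw [show (1 - 2 * x) * 1 + 2 * x * (1 / 2) = 1 - x by ring,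
    show (1 / 2 : ℝ) = 2⁻¹ by norm_num, Real.log_inv] at h
  have : -(2 * x) ≤ Real.logb 2 (1 - x) := by
    rw [Real.logb, le_div_iff₀ hl]; linarith
  linarith

/-- relative-loss bound. With `L̄` the average per-Hz loss bound,
`R` the ideal rate, and `c` the spectral-efficiency lower bound (assumed
positive), `L̄·B/R ≤ (ξ/c)·2^{−2d} + (1/c)·2^{−d+3.5}`. -/
theorem stmt_16 {p : ℕ} (hp : 2 ≤ p) (β B P σ2 γ1 γ2 Γ d : ℝ)
    (hβ : 0 < β) (hB : 0 < B) (hP : 0 < P) (hσ : 0 < σ2)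
    (hγ1 : 0 ≤ γ1) (hγ2 : 0 ≤ γ2) (hΓ : 1 ≤ Γ) (hd : 3 ≤ d)
    (ρ ξ c : ℝ)
    (hρ : ρ = (1 + γ1) ^ 2 + 12 * (1 + γ1) * γ2 / β ^ 2 + 240 * (γ2 / β ^ 2) ^ 2)
    (hξ : ξ = (4 / Real.log 2) * ((p : ℝ) - 1) * (P / σ2) * (1 / (β ^ 2 * B)) * ρ)
    (hc : c = (1 / 3) * Real.logb 2 (P / (σ2 * Γ))
      + (2 / 3) * Real.logb 2 ((P / (σ2 * Γ)) * Real.exp (-β * Real.sqrt B)))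
    (hcpos : 0 < c)
    (Lbar R : ℝ)
    (hLbar : Lbar = (1 / B) * (∫ f in (0 : ℝ)..B,
        Real.logb 2 (1 + 2 * ((p : ℝ) - 1) * (2 : ℝ) ^ (-(2 * d))
          * (1 + γ1 + γ2 * f) ^ 2 * (P / σ2) * Real.exp (-β * Real.sqrt f)))
      - 2 * Real.logb 2 (1 - (2 : ℝ) ^ (-d + 1.5)))
    (hR : R = ∫ f in (0 : ℝ)..B,
      Real.logb 2 (1 + (P / (σ2 * Γ)) * Real.exp (-β * Real.sqrt f))) :
    Lbar * B / R ≤ (ξ / c) * (2 : ℝ) ^ (-(2 * d)) + (1 / c) * (2 : ℝ) ^ (-d + 3.5) := by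
  have hl : 0 < Real.log 2 := Real.log_pos (by norm_num)
  have hp1 : (0 : ℝ) < (p : ℝ) - 1 := by
    have : (2 : ℝ) ≤ p := by exact_mod_cast hp
    linarith
  have hG : 0 < Γ := by linarith
  obtain ⟨S, hS⟩ : ∃ S, S = P / (σ2 * Γ) := ⟨_, rfl⟩
  have hS0 : 0 < S := by rw [hS]; positivity
  rw [← hS] at hc hR
  have hlogb : ∀ f : ℝ, Real.logb 2 (S * Real.exp (-β * Real.sqrt f))
      = Real.logb 2 S + (-β / Real.log 2) * Real.sqrt f := by
    intro f
    rw [Real.logb_mul hS0.ne' (Real.exp_pos _).ne']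
    simp only [Real.logb, Real.log_exp]
    ring
  -- lower bound on R
  have hRc : c * B ≤ R := by
    have e : c * B = ∫ f in (0 : ℝ)..B, (Real.logb 2 S + (-β / Real.log 2) * Real.sqrt f) := by
      rw [intervalIntegral.integral_add (by simp)
        (Continuous.intervalIntegrable (by fun_prop) _ _),
        intervalIntegral.integral_const_mul, aux_int_sqrt B hB, hc, hlogb]
      simp
      ring
    rw [e, hR]
    refine intervalIntegral.integral_mono_on hB.le
      (Continuous.intervalIntegrable (by fun_prop) _ _) ?_ ?_
    · refine Continuous.intervalIntegrable ?_ _ _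
      simp only [Real.logb]
      refine Continuous.div_const (Continuous.log (by fun_prop) ?_) _
      intro x
      positivity
    · intro x _
      rw [← hlogb]
      exact Real.logb_le_logb_of_le (by norm_num) (by positivity) (by linarith)
  -- upper bound on the loss integral
  obtain ⟨T, hT⟩ : ∃ T, T = (2 : ℝ) ^ (-(2 * d)) := ⟨_, rfl⟩
  have hT0 : 0 < T := by rw [hT]; positivity
  rw [← hT] at hLbar ⊢
  have hI : (∫ f in (0 : ℝ)..B,
        Real.logb 2 (1 + 2 * ((p : ℝ) - 1) * T
          * (1 + γ1 + γ2 * f) ^ 2 * (P / σ2) * Real.exp (-β * Real.sqrt f))) ≤ ξ * T * B := by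
    have h1 : (∫ f in (0 : ℝ)..B,
        Real.logb 2 (1 + 2 * ((p : ℝ) - 1) * T
          * (1 + γ1 + γ2 * f) ^ 2 * (P / σ2) * Real.exp (-β * Real.sqrt f)))
        ≤ ∫ f in (0 : ℝ)..B, (2 * ((p : ℝ) - 1) * T * (P / σ2) / Real.log 2) *
          ((1 + γ1 + γ2 * f) ^ 2 * Real.exp (-β * Real.sqrt f)) := by
      refine intervalIntegral.integral_mono_on hB.le ?_
        (Continuous.intervalIntegrable (by fun_prop) _ _) ?_
      · refine Continuous.intervalIntegrable ?_ _ _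
        simp only [Real.logb]
        refine Continuous.div_const (Continuous.log (by fun_prop) ?_) _
        intro x
        positivity
      · intro x _
        rw [Real.logb, div_le_iff₀ hl]
        have h := Real.log_le_sub_one_of_pos (x := 1 + 2 * ((p : ℝ) - 1) * T
          * (1 + γ1 + γ2 * x) ^ 2 * (P / σ2) * Real.exp (-β * Real.sqrt x)) (by positivity)
        refine h.trans (le_of_eq ?_)
        field_simp
        ring
    rw [intervalIntegral.integral_const_mul] at h1
    refine h1.trans ?_
    refine (mul_le_mul_of_nonneg_left
      (aux_int_loss β B (1 + γ1) γ2 hβ hB (by linarith) hγ2) (by positivity)).trans (le_of_eq ?_)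
    rw [← hρ, hξ]
    field_simp
    ring
  have hX : -(2 * Real.logb 2 (1 - (2 : ℝ) ^ (-d + 1.5))) ≤ (2 : ℝ) ^ (-d + 3.5) := by
    have h4 : (2 : ℝ) ^ (-d + 3.5) = 4 * (2 : ℝ) ^ (-d + 1.5) := by
      rw [show -d + 3.5 = (-d + 1.5) + 2 by ring, Real.rpow_add (by norm_num)]
      norm_num
      ring
    rw [h4]
    refine aux_log_s16 _ (by positivity) ?_
    have : (2 : ℝ) ^ (-d + 1.5) ≤ (2 : ℝ) ^ (-1 : ℝ) :=
      Real.rpow_le_rpow_of_exponent_le (by norm_num) (by norm_num; linarith)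
    rw [Real.rpow_neg_one] at this
    linarith
  obtain ⟨Y, hY⟩ : ∃ Y, Y = (2 : ℝ) ^ (-d + 3.5) := ⟨_, rfl⟩
  have hY0 : 0 < Y := by rw [hY]; positivity
  rw [← hY] at hX ⊢
  have hρ0 : 0 ≤ ρ := by rw [hρ]; positivity
  have hξ0 : 0 ≤ ξ := by rw [hξ]; positivity
  have hL : Lbar * B ≤ (ξ * T + Y) * B := by
    refine mul_le_mul_of_nonneg_right ?_ hB.le
    rw [hLbar]
    have : 1 / B * (∫ f in (0 : ℝ)..B,
        Real.logb 2 (1 + 2 * ((p : ℝ) - 1) * T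
          * (1 + γ1 + γ2 * f) ^ 2 * (P / σ2) * Real.exp (-β * Real.sqrt f))) ≤ ξ * T := by
      rw [one_div, inv_mul_le_iff₀ hB]; linarith
    linarith
  have hcB : 0 < c * B := by positivity
  calc Lbar * B / R ≤ (ξ * T + Y) * B / R := by
        have : 0 < R := hcB.trans_le hRc
        gcongr
    _ ≤ (ξ * T + Y) * B / (c * B) := by gcongr
    _ = ξ / c * T + 1 / c * Y := by field_simp
end
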